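/- arXiv:1204.5014 — 7 statements merged into one kernel-verified Lean document; each statement's English description precedes it below -/
import Mathlib

section
/- Let A, B, C be three affinely independent points of the Euclidean plane E (a nondegenerate triangle). Then there exist points O₁, O₂, O₃ in the interior of the convex hull of {A, B, C} and radii r₁, r₂, r₃ > 0 such that: dist(Oᵢ, Oⱼ) = rᵢ + rⱼ for all i ≠ j (the three circles touch each other pairwise from outside); infDist(O₁, affineSpan{A,B}) = r₁ and infDist(O₁, affineSpan{A,C}) = r₁ (the first circle touches the two sides through A); infDist(O₂, affineSpan{B,A}) = r₂ and infDist(O₂, affineSpan{B,C}) = r₂; and infDist(O₃, affineSpan{C,A}) = r₃ and infDist(O₃, affineSpan{C,B}) = r₃. That is, Malfatti's original problem has a solution for every triangle. -/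
/-- The tangent of half an angle is determined by its cotangent. -/
theorem exists_half_tangent {x r : ℝ} (hx : 0 < x) (hr : 0 < r) :
    ∃ p : ℝ, 0 < p ∧ p < 1 ∧ 2 * p * x = r * (1 - p ^ 2) := by
  have hd : √(x ^ 2 + r ^ 2) ^ 2 = x ^ 2 + r ^ 2 := Real.sq_sqrt (by positivity)
  have hd0 := Real.sqrt_nonneg (x ^ 2 + r ^ 2)
  set d := √(x ^ 2 + r ^ 2)
  have hlt : x < d := by nlinarith [sq_pos_of_pos hr]
  have hlt' : d < x + r := by nlinarith [mul_pos hx hr]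
  refine ⟨(d - x) / r, div_pos (by linarith) hr, (div_lt_one hr).2 (by linarith), ?_⟩
  field_simp
  linear_combination hd

/-- If three half angles add up to a right angle, then the tangents of their halves satisfy the
addition formula for `π / 4`. -/
theorem half_tangent_relation {x y z r p q w : ℝ} (hr : 0 < r)
    (h : r ^ 2 * (x + y + z) = x * y * z)
    (hp : 0 < p) (hp1 : p < 1) (hq : 0 < q) (hq1 : q < 1) (hw : 0 < w) (hw1 : w < 1)
    (hpx : 2 * p * x = r * (1 - p ^ 2)) (hqy : 2 * q * y = r * (1 - q ^ 2))
    (hwz : 2 * w * z = r * (1 - w ^ 2)) :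
    p + q + w - p * q * w = 1 - p * q - q * w - w * p := by
  have hpos : 0 < 1 + p + q + w - p * q - q * w - w * p - p * q * w := by
    nlinarith [mul_pos hp (sub_pos.2 hq1), mul_pos hq (sub_pos.2 hw1), mul_pos hw (sub_pos.2 hp1),
      mul_pos (mul_pos hp hq) hw, mul_pos (sub_pos.2 hp1) (sub_pos.2 hq1),
      mul_lt_one_of_nonneg_of_lt_one_left (mul_pos hp hq).le
        (mul_lt_one_of_nonneg_of_lt_one_left hp.le hp1 hq1.le) hw1.le]
  have hxe : x = r * (1 - p ^ 2) / (2 * p) := by field_simp; linear_combination hpx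
  have hye : y = r * (1 - q ^ 2) / (2 * q) := by field_simp; linear_combination hqy
  have hze : z = r * (1 - w ^ 2) / (2 * w) := by field_simp; linear_combination hwz
  rw [hxe, hye, hze] at h
  field_simp at h
  have key : (1 + p + q + w - p * q - q * w - w * p - p * q * w) *
      (p + q + w - p * q * w - (1 - p * q - q * w - w * p)) = 0 := by
    linear_combination h
  rcases mul_eq_zero.1 key with h0 | h0 <;> linarith

/-- The ratio of the Malfatti radius at one vertex to the inradius. -/
theorem malfatti_ratio {x r p q w : ℝ} (hx : 0 < x) (hr : 0 < r)
    (hp : 0 < p) (hp1 : p < 1) (hq : 0 < q) (hw : 0 < w)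
    (hpx : 2 * p * x = r * (1 - p ^ 2))
    (hrel : p + q + w - p * q * w = 1 - p * q - q * w - w * p) :
    (1 - (1 + q) * (1 + w) / (2 * (1 + p))) * x = r * (1 + q + w - p) / 2 ∧
      0 < (1 + q) * (1 + w) / (2 * (1 + p)) ∧ (1 + q) * (1 + w) / (2 * (1 + p)) < 1 := by
  have h : (1 - (1 + q) * (1 + w) / (2 * (1 + p))) * x = r * (1 + q + w - p) / 2 := by
    have hxe : x = r * (1 - p ^ 2) / (2 * p) := by field_simp; linear_combination hpx
    rw [hxe]
    field_simp
    linear_combination (-(1 + p)) * hrel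
  refine ⟨h, by positivity, ?_⟩
  have : 0 < r * (1 + q + w - p) / 2 := by
    have : 0 < 1 + q + w - p := by linarith
    positivity
  rw [← h] at this
  linarith [pos_of_mul_pos_left this hx.le]

/-- Solution of Malfatti's equations, where `x`, `y`, `z` are the tangent lengths from the vertices
to the incircle, `r` is the inradius, and the unknowns are the ratios of the Malfatti radii to
the inradius. -/
theorem exists_malfatti_ratios {x y z r : ℝ} (hx : 0 < x) (hy : 0 < y) (hz : 0 < z) (hr : 0 < r)
    (h : r ^ 2 * (x + y + z) = x * y * z) :
    ∃ k l m : ℝ, (0 < k ∧ k < 1) ∧ (0 < l ∧ l < 1) ∧ (0 < m ∧ m < 1) ∧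
      ((1 - k) * x + (1 - l) * y) ^ 2 = 4 * k * l * r ^ 2 ∧
      ((1 - l) * y + (1 - m) * z) ^ 2 = 4 * l * m * r ^ 2 ∧
      ((1 - k) * x + (1 - m) * z) ^ 2 = 4 * k * m * r ^ 2 := by
  obtain ⟨p, hp, hp1, hpx⟩ := exists_half_tangent hx hr
  obtain ⟨q, hq, hq1, hqy⟩ := exists_half_tangent hy hr
  obtain ⟨w, hw, hw1, hwz⟩ := exists_half_tangent hz hr
  have hrel := half_tangent_relation hr h hp hp1 hq hq1 hw hw1 hpx hqy hwz
  obtain ⟨hk, hk0, hk1⟩ := malfatti_ratio hx hr hp hp1 hq hw hpx hrel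
  obtain ⟨hl, hl0, hl1⟩ := malfatti_ratio hy hr hq hq1 hw hp hqy (by linarith)
  obtain ⟨hm, hm0, hm1⟩ := malfatti_ratio hz hr hw hw1 hp hq hwz (by linarith)
  refine ⟨_, _, _, ⟨hk0, hk1⟩, ⟨hl0, hl1⟩, ⟨hm0, hm1⟩, ?_, ?_, ?_⟩
  · rw [hk, hl]; field_simp; ring
  · rw [hl, hm]; field_simp; ring
  · rw [hk, hm]; field_simp; ring

section InnerProductSpace

variable {V : Type*} [NormedAddCommGroup V] [InnerProductSpace ℝ V]

/-- The distance to a line is attained at the foot of the perpendicular. -/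
theorem infDist_line_eq_dist_of_inner_eq_zero {A B F P : V} (hF : F ∈ line[ℝ, A, B])
    (h : inner ℝ (P - F) (B - A) = 0) :
    Metric.infDist P (line[ℝ, A, B] : Set V) = dist P F := by
  have hproj : (EuclideanGeometry.orthogonalProjection line[ℝ, A, B] P : V) = F := by
    refine EuclideanGeometry.coe_orthogonalProjection_eq_iff_mem.2 ⟨hF, ?_⟩
    rw [direction_affineSpan, vectorSpan_pair_rev, Submodule.mem_orthogonal_singleton_iff_inner_left]
    exact h
  rw [← hproj, EuclideanGeometry.dist_orthogonalProjection_eq_infDist]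

theorem two_mul_inner_sub_sub (I A B : V) :
    2 * inner ℝ (I - A) (B - A) = dist I A ^ 2 + dist A B ^ 2 - dist I B ^ 2 := by
  have := norm_sub_sq_real (I - A) (B - A)
  rw [sub_sub_sub_cancel_right] at this
  rw [dist_eq_norm, dist_eq_norm, dist_eq_norm, norm_sub_rev A B]
  linarith

/-- A point on the bisector joining a vertex to the incenter is at the proportional distance
from the adjacent side. -/
theorem infDist_side_of_incenter {A B I : V} {x y r k : ℝ} (hx : 0 < x) (hy : 0 < y) (hr : 0 < r)
    (hk : 0 < k) (hAB : dist A B = x + y) (hA : dist I A ^ 2 = x ^ 2 + r ^ 2)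
    (hB : dist I B ^ 2 = y ^ 2 + r ^ 2) :
    Metric.infDist (A + k • (I - A)) (line[ℝ, A, B] : Set V) = k * r := by
  have hin := two_mul_inner_sub_sub I A B
  rw [hA, hB, hAB] at hin
  have hBA : ‖B - A‖ = x + y := by rw [← dist_eq_norm, dist_comm, hAB]
  have hc : x + y ≠ 0 := by positivity
  have hvec : A + k • (I - A) - AffineMap.lineMap A B (k * x / (x + y)) =
      k • ((I - A) - (x / (x + y)) • (B - A)) := by
    rw [AffineMap.lineMap_apply]
    simp only [vsub_eq_sub, vadd_eq_add]
    module
  rw [infDist_line_eq_dist_of_inner_eq_zero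
    (AffineMap.lineMap_mem_affineSpan_pair (k * x / (x + y)) A B)]
  · rw [dist_eq_norm, hvec, ← sq_eq_sq₀ (norm_nonneg _) (by positivity), norm_smul, mul_pow,
      Real.norm_eq_abs, sq_abs, norm_sub_sq_real, inner_smul_right, norm_smul, mul_pow,
      Real.norm_eq_abs, sq_abs, hBA, ← dist_eq_norm, hA]
    field_simp
    linear_combination (-x) * hin
  · rw [hvec, inner_smul_left, inner_sub_left, inner_smul_left, real_inner_self_eq_norm_sq, hBA]
    simp only [conj_trivial]
    field_simp
    linear_combination k / 2 * hin

/-- Two circles inscribed in adjacent angles of a triangle touch each other when their radii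
satisfy Malfatti's equation for the common side. -/
theorem dist_eq_of_malfatti_equation {A B I : V} {x y r k l : ℝ} (hr : 0 < r) (hk : 0 < k)
    (hl : 0 < l) (hAB : dist A B = x + y) (hA : dist I A ^ 2 = x ^ 2 + r ^ 2)
    (hB : dist I B ^ 2 = y ^ 2 + r ^ 2)
    (h : ((1 - k) * x + (1 - l) * y) ^ 2 = 4 * k * l * r ^ 2) :
    dist (A + k • (I - A)) (B + l • (I - B)) = k * r + l * r := by
  have hin := norm_sub_sq_real (I - A) (I - B)
  rw [sub_sub_sub_cancel_left, ← dist_eq_norm, ← dist_eq_norm, ← dist_eq_norm, dist_comm B A, hA,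
    hB, hAB] at hin
  have hvec : A + k • (I - A) - (B + l • (I - B)) = (1 - l) • (I - B) - (1 - k) • (I - A) := by
    module
  rw [dist_eq_norm, hvec, ← sq_eq_sq₀ (norm_nonneg _) (by positivity), norm_sub_sq_real,
    norm_smul, norm_smul, mul_pow, mul_pow, inner_smul_left, inner_smul_right,
    real_inner_comm, Real.norm_eq_abs, Real.norm_eq_abs, sq_abs, sq_abs, ← dist_eq_norm,
    ← dist_eq_norm, hA, hB]
  simp only [conj_trivial]
  linear_combination h - (1 - k) * (1 - l) * hin

/-- The distance from a vertex of a triangle to the incenter. -/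
theorem dist_incenter_sq {A B C I : V} {x y z r : ℝ} (hx : 0 < x) (hy : 0 < y) (hz : 0 < z)
    (h : r ^ 2 * (x + y + z) = x * y * z)
    (hAB : dist A B = x + y) (hAC : dist A C = x + z) (hBC : dist B C = y + z)
    (hI : (2 * (x + y + z)) • I = (y + z) • A + (x + z) • B + (x + y) • C) :
    dist I A ^ 2 = x ^ 2 + r ^ 2 := by
  have hs : (2 * (x + y + z)) • (I - A) = (x + z) • (B - A) + (x + y) • (C - A) := by
    rw [smul_sub, hI]; module
  have hin := two_mul_inner_sub_sub B A C
  rw [dist_comm B A, hAB, hAC, hBC] at hin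
  have hn := congrArg (fun v : V => ‖v‖ ^ 2) hs
  simp only [norm_add_sq_real, norm_smul, mul_pow, Real.norm_eq_abs, sq_abs, inner_smul_left,
    inner_smul_right, conj_trivial, ← dist_eq_norm, dist_comm B A, dist_comm C A, hAB, hAC] at hn
  have hs0 : (2 * (x + y + z)) ^ 2 ≠ 0 := by positivity
  apply mul_left_cancel₀ hs0
  linear_combination hn + (x + z) * (x + y) * hin - 4 * (x + y + z) * h

end InnerProductSpace

theorem dist_lt_dist_add_dist_of_affineIndependent {V P : Type*} [NormedAddCommGroup V]
    [NormedSpace ℝ V] [StrictConvexSpace ℝ V] [MetricSpace P] [NormedAddTorsor V P] {A B C : P}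
    (h : AffineIndependent ℝ ![A, B, C]) : dist A C < dist A B + dist B C := by
  refine lt_of_le_of_ne (dist_triangle _ _ _) fun heq => ?_
  exact affineIndependent_iff_not_collinear_set.1 h (dist_add_dist_eq_iff.1 heq.symm).collinear

/-- A point with positive barycentric coordinates lies in the interior of the triangle. -/
theorem mem_interior_convexHull_triangle {A B C P : EuclideanSpace ℝ (Fin 2)}
    (hABC : AffineIndependent ℝ ![A, B, C]) {a b c : ℝ} (ha : 0 < a) (hb : 0 < b) (hc : 0 < c)
    (hsum : a + b + c = 1) (hP : P = a • A + b • B + c • C) :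
    P ∈ interior (convexHull ℝ ({A, B, C} : Set (EuclideanSpace ℝ (Fin 2)))) := by
  let S : AffineBasis (Fin 3) ℝ (EuclideanSpace ℝ (Fin 2)) :=
    ⟨![A, B, C], hABC, hABC.affineSpan_eq_top_iff_card_eq_finrank_add_one.2 (by simp)⟩
  have hrange : Set.range S = {A, B, C} := by
    change Set.range ![A, B, C] = _
    rw [Matrix.range_cons, Matrix.range_cons, Matrix.range_cons, Matrix.range_empty]
    rw [Set.union_empty, Set.singleton_union, Set.singleton_union]
  rw [← hrange, S.interior_convexHull]
  have hw : ∑ i, ![a, b, c] i = 1 := by simpa [Fin.sum_univ_three] using hsum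
  have hPc : P = Finset.univ.affineCombination ℝ S ![a, b, c] := by
    rw [Finset.affineCombination_eq_linear_combination _ _ _ hw, Fin.sum_univ_three]
    exact hP
  intro i
  rw [hPc, S.coord_apply_combination_of_mem (Finset.mem_univ i) hw]
  fin_cases i <;> assumption

/-- Malfatti's original problem has a solution for every nondegenerate triangle
in the Euclidean plane. -/
theorem malfatti_triangle
    (A B C : EuclideanSpace ℝ (Fin 2))
    (hABC : AffineIndependent ℝ ![A, B, C]) :
    ∃ (O₁ O₂ O₃ : EuclideanSpace ℝ (Fin 2)) (r₁ r₂ r₃ : ℝ),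
      0 < r₁ ∧ 0 < r₂ ∧ 0 < r₃ ∧
      O₁ ∈ interior (convexHull ℝ ({A, B, C} : Set (EuclideanSpace ℝ (Fin 2)))) ∧
      O₂ ∈ interior (convexHull ℝ ({A, B, C} : Set (EuclideanSpace ℝ (Fin 2)))) ∧
      O₃ ∈ interior (convexHull ℝ ({A, B, C} : Set (EuclideanSpace ℝ (Fin 2)))) ∧
      dist O₁ O₂ = r₁ + r₂ ∧ dist O₂ O₃ = r₂ + r₃ ∧ dist O₁ O₃ = r₁ + r₃ ∧
      Metric.infDist O₁ (affineSpan ℝ ({A, B} : Set (EuclideanSpace ℝ (Fin 2)))) = r₁ ∧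
      Metric.infDist O₁ (affineSpan ℝ ({A, C} : Set (EuclideanSpace ℝ (Fin 2)))) = r₁ ∧
      Metric.infDist O₂ (affineSpan ℝ ({B, A} : Set (EuclideanSpace ℝ (Fin 2)))) = r₂ ∧
      Metric.infDist O₂ (affineSpan ℝ ({B, C} : Set (EuclideanSpace ℝ (Fin 2)))) = r₂ ∧
      Metric.infDist O₃ (affineSpan ℝ ({C, A} : Set (EuclideanSpace ℝ (Fin 2)))) = r₃ ∧
      Metric.infDist O₃ (affineSpan ℝ ({C, B} : Set (EuclideanSpace ℝ (Fin 2)))) = r₃ := by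
  have hperm : ∀ X Y Z : EuclideanSpace ℝ (Fin 2),
      ({X, Y, Z} : Set (EuclideanSpace ℝ (Fin 2))) = {A, B, C} → AffineIndependent ℝ ![X, Y, Z] :=
    fun X Y Z h => affineIndependent_iff_not_collinear_set.2
      (h ▸ affineIndependent_iff_not_collinear_set.1 hABC)
  have h₁ := dist_lt_dist_add_dist_of_affineIndependent (hperm B A C (Set.insert_comm _ _ _))
  have h₂ := dist_lt_dist_add_dist_of_affineIndependent hABC
  have h₃ := dist_lt_dist_add_dist_of_affineIndependent (hperm A C B (by rw [Set.pair_comm]))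
  rw [dist_comm B A] at h₁
  rw [dist_comm C B] at h₃
  obtain ⟨x, hx⟩ : ∃ x, x = (dist A B + dist A C - dist B C) / 2 := ⟨_, rfl⟩
  obtain ⟨y, hy⟩ : ∃ y, y = (dist A B + dist B C - dist A C) / 2 := ⟨_, rfl⟩
  obtain ⟨z, hz⟩ : ∃ z, z = (dist A C + dist B C - dist A B) / 2 := ⟨_, rfl⟩
  have hAB : dist A B = x + y := by linarith
  have hAC : dist A C = x + z := by linarith
  have hBC : dist B C = y + z := by linarith
  have hx0 : 0 < x := by linarith
  have hy0 : 0 < y := by linarith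
  have hz0 : 0 < z := by linarith
  clear hx hy hz h₁ h₂ h₃
  obtain ⟨r, hr, hrs⟩ : ∃ r : ℝ, 0 < r ∧ r ^ 2 * (x + y + z) = x * y * z := by
    refine ⟨√(x * y * z / (x + y + z)), by positivity, ?_⟩
    rw [Real.sq_sqrt (by positivity)]
    field_simp
  obtain ⟨I, hI⟩ : ∃ I : EuclideanSpace ℝ (Fin 2), I = ((y + z) / (2 * (x + y + z))) • A +
    ((x + z) / (2 * (x + y + z))) • B + ((x + y) / (2 * (x + y + z))) • C := ⟨_, rfl⟩
  have hIint : I ∈ interior (convexHull ℝ ({A, B, C} : Set (EuclideanSpace ℝ (Fin 2)))) :=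
    mem_interior_convexHull_triangle hABC (by positivity) (by positivity) (by positivity)
      (by field_simp; ring) hI
  have hIs : (2 * (x + y + z)) • I = (y + z) • A + (x + z) • B + (x + y) • C := by
    have hs : 2 * (x + y + z) ≠ 0 := by positivity
    rw [hI, smul_add, smul_add, smul_smul, smul_smul, smul_smul, mul_div_cancel₀ _ hs,
      mul_div_cancel₀ _ hs, mul_div_cancel₀ _ hs]
  have hIA := dist_incenter_sq hx0 hy0 hz0 hrs hAB hAC hBC hIs
  have hIB : dist I B ^ 2 = y ^ 2 + r ^ 2 := by
    refine dist_incenter_sq (A := B) (B := A) (C := C) hy0 hx0 hz0 (by linarith)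
      (by rw [dist_comm, hAB, add_comm]) hBC hAC ?_
    rw [add_comm y x, hIs]; abel
  have hIC : dist I C ^ 2 = z ^ 2 + r ^ 2 := by
    refine dist_incenter_sq (A := C) (B := A) (C := B) hz0 hx0 hy0 (by linarith)
      (by rw [dist_comm, hAC, add_comm]) (by rw [dist_comm, hBC, add_comm]) hAB ?_
    rw [show z + x + y = x + y + z by ring, hIs, add_comm z y, add_comm z x]; abel
  have hmem : ∀ X ∈ ({A, B, C} : Set (EuclideanSpace ℝ (Fin 2))), ∀ k : ℝ, 0 < k ∧ k < 1 →
      X + k • (I - X) ∈ interior (convexHull ℝ ({A, B, C} : Set (EuclideanSpace ℝ (Fin 2)))) := by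
    intro X hX k hk
    rw [show X + k • (I - X) = k • I + (1 - k) • X by module]
    exact (convex_convexHull ℝ _).combo_interior_self_mem_interior hIint
      (subset_convexHull ℝ _ hX) hk.1 (by linarith) (by ring)
  obtain ⟨k, l, m, hk, hl, hm, hkl, hlm, hkm⟩ := exists_malfatti_ratios hx0 hy0 hz0 hr hrs
  have hBA : dist B A = y + x := by rw [dist_comm, hAB, add_comm]
  have hCA : dist C A = z + x := by rw [dist_comm, hAC, add_comm]
  have hCB : dist C B = z + y := by rw [dist_comm, hBC, add_comm]
  exact ⟨A + k • (I - A), B + l • (I - B), C + m • (I - C), k * r, l * r, m * r,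
    mul_pos hk.1 hr, mul_pos hl.1 hr, mul_pos hm.1 hr,
    hmem A (by simp) k hk, hmem B (by simp) l hl, hmem C (by simp) m hm,
    dist_eq_of_malfatti_equation hr hk.1 hl.1 hAB hIA hIB hkl,
    dist_eq_of_malfatti_equation hr hl.1 hm.1 hBC hIB hIC hlm,
    dist_eq_of_malfatti_equation hr hk.1 hm.1 hAC hIA hIC hkm,
    infDist_side_of_incenter hx0 hy0 hr hk.1 hAB hIA hIB,
    infDist_side_of_incenter hx0 hz0 hr hk.1 hAC hIA hIC,
    infDist_side_of_incenter hy0 hx0 hr hl.1 hBA hIB hIA,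
    infDist_side_of_incenter hy0 hz0 hr hl.1 hBC hIB hIC,
    infDist_side_of_incenter hz0 hx0 hr hm.1 hCA hIC hIA,
    infDist_side_of_incenter hz0 hy0 hr hm.1 hCB hIC hIB⟩
end

section
/- Let (O₁, r₁) and (O₂, r₂) be two circles in the Euclidean plane E with d := dist(O₁, O₂) > r₁ + r₂ (non-overlapping circles), and let P ∈ E be a point with dist(P, O₁) ≥ r₁ and dist(P, O₂) ≥ r₂. Set t₁ := √(dist(P, O₁)² − r₁²) and t₂ := √(dist(P, O₂)² − r₂²) (the tangent lengths from P to the two circles), and set T_ext := √(d² − (r₁ − r₂)²) and T_int := √(d² − (r₁ + r₂)²) (the lengths of the external and internal common tangent segments). Then P lies on a common tangent line of the two circles — i.e., there exists a one-dimensional affine subspace ℓ of E with P ∈ ℓ, infDist(O₁, ℓ) = r₁ and infDist(O₂, ℓ) = r₂ — if and only if t₁ + t₂ = T_ext, or t₁ + t₂ = T_int, or |t₁ − t₂| = T_ext, or |t₁ − t₂| = T_int. -/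
/-- The distance from a point to the line through `P` with unit direction `u`, in coordinates. -/
theorem infDist_mk'_span_singleton (X P u : EuclideanSpace ℝ (Fin 2))
    (hu : u 0 ^ 2 + u 1 ^ 2 = 1) :
    Metric.infDist X (AffineSubspace.mk' P (Submodule.span ℝ {u}) :
        Set (EuclideanSpace ℝ (Fin 2)))
      = |u 0 * (X 1 - P 1) - u 1 * (X 0 - P 0)| := by
  apply le_antisymm
  · set c := u 0 * (X 0 - P 0) + u 1 * (X 1 - P 1) with hc
    have hmem : c • u + P ∈ (AffineSubspace.mk' P (Submodule.span ℝ {u}) :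
        Set (EuclideanSpace ℝ (Fin 2))) := by
      simp [AffineSubspace.mem_mk', Submodule.mem_span_singleton]
    refine (Metric.infDist_le_dist_of_mem hmem).trans_eq ?_
    rw [EuclideanSpace.dist_eq, ← Real.sqrt_sq_eq_abs]
    congr 1
    simp only [Fin.sum_univ_two, Real.dist_eq, sq_abs, PiLp.add_apply, PiLp.smul_apply,
      smul_eq_mul]
    rw [hc]
    linear_combination
      ((u 0 * (X 0 - P 0) + u 1 * (X 1 - P 1)) ^ 2 - (X 0 - P 0) ^ 2 - (X 1 - P 1) ^ 2) * hu
  · refine (Metric.le_infDist ⟨P, AffineSubspace.self_mem_mk' _ _⟩).2 fun z hz => ?_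
    obtain ⟨c, hc⟩ := Submodule.mem_span_singleton.1 ((AffineSubspace.mem_mk').1 hz)
    have h0 : c * u 0 = z 0 - P 0 := congrArg (fun w : EuclideanSpace ℝ (Fin 2) => w 0) hc
    have h1 : c * u 1 = z 1 - P 1 := congrArg (fun w : EuclideanSpace ℝ (Fin 2) => w 1) hc
    rw [EuclideanSpace.dist_eq]
    apply Real.abs_le_sqrt
    simp only [Fin.sum_univ_two, Real.dist_eq, sq_abs]
    have hz0 : z 0 = P 0 + c * u 0 := by linarith
    have hz1 : z 1 = P 1 + c * u 1 := by linarith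
    rw [hz0, hz1]
    have key := sq_nonneg (u 0 * (X 0 - P 0) + u 1 * (X 1 - P 1) - c)
    linear_combination key +
      ((X 0 - P 0) ^ 2 + (X 1 - P 1) ^ 2 - c ^ 2) * hu

/-- A line through `P` at prescribed distances from two points corresponds to a unit direction
vector with prescribed absolute cross products. -/
theorem exists_line_infDist_iff (X Y P : EuclideanSpace ℝ (Fin 2)) (r s : ℝ) :
    (∃ ℓ : AffineSubspace ℝ (EuclideanSpace ℝ (Fin 2)),
        Module.finrank ℝ ℓ.direction = 1 ∧ P ∈ ℓ ∧
        Metric.infDist X (ℓ : Set (EuclideanSpace ℝ (Fin 2))) = r ∧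
        Metric.infDist Y (ℓ : Set (EuclideanSpace ℝ (Fin 2))) = s) ↔
      ∃ p q : ℝ, p ^ 2 + q ^ 2 = 1 ∧ |p * (X 1 - P 1) - q * (X 0 - P 0)| = r ∧
        |p * (Y 1 - P 1) - q * (Y 0 - P 0)| = s := by
  constructor
  · rintro ⟨ℓ, hdim, hP, hX, hY⟩
    obtain ⟨v, hv0, hv⟩ := finrank_eq_one_iff'.1 hdim
    have hvE : (v : EuclideanSpace ℝ (Fin 2)) ≠ 0 := by simpa using hv0
    set u : EuclideanSpace ℝ (Fin 2) := (‖(v : EuclideanSpace ℝ (Fin 2))‖⁻¹ : ℝ) • v with hu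
    have hnorm : ‖u‖ = 1 := norm_smul_inv_norm (𝕜 := ℝ) hvE
    have hu1 : u 0 ^ 2 + u 1 ^ 2 = 1 := by
      have h := EuclideanSpace.real_norm_sq_eq u
      rw [hnorm, Fin.sum_univ_two] at h
      linarith
    have hdir : ℓ.direction = Submodule.span ℝ {u} := by
      apply le_antisymm
      · intro w hw
        obtain ⟨c, hc⟩ := hv ⟨w, hw⟩
        have hc' : c • (v : EuclideanSpace ℝ (Fin 2)) = w := congrArg Subtype.val hc
        refine Submodule.mem_span_singleton.2 ⟨c * ‖(v : EuclideanSpace ℝ (Fin 2))‖, ?_⟩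
        rw [hu, smul_smul, mul_assoc, mul_inv_cancel₀ (norm_ne_zero_iff.2 hvE), mul_one, hc']
      · rw [Submodule.span_singleton_le_iff_mem]
        exact ℓ.direction.smul_mem _ v.2
    have hℓ : AffineSubspace.mk' P (Submodule.span ℝ {u}) = ℓ := by
      rw [← hdir, AffineSubspace.mk'_eq hP]
    refine ⟨u 0, u 1, hu1, ?_, ?_⟩
    · rw [← infDist_mk'_span_singleton X P u hu1, hℓ, hX]
    · rw [← infDist_mk'_span_singleton Y P u hu1, hℓ, hY]
  · rintro ⟨p, q, hpq, hX, hY⟩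
    have hu : (!₂[p, q] : EuclideanSpace ℝ (Fin 2)) 0 ^ 2 + !₂[p, q] 1 ^ 2 = 1 := by
      simpa using hpq
    refine ⟨AffineSubspace.mk' P (Submodule.span ℝ {!₂[p, q]}), ?_,
      AffineSubspace.self_mem_mk' _ _, ?_, ?_⟩
    · rw [AffineSubspace.direction_mk']
      apply finrank_span_singleton
      intro h
      rw [h] at hu
      simp at hu
    · rw [infDist_mk'_span_singleton X P _ hu]
      simpa using hX
    · rw [infDist_mk'_span_singleton Y P _ hu]
      simpa using hY

/-- Two plane vectors whose inner product agrees with that of `(r, t)` and `(s, w)`, and whose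
norms agree as well, admit a unit vector whose cross products with them are `r` and `s`. -/
theorem exists_unit_cross_eq {a₀ a₁ b₀ b₁ r s t w : ℝ} (hr : r ≠ 0)
    (ha : a₀ ^ 2 + a₁ ^ 2 = r ^ 2 + t ^ 2) (hb : b₀ ^ 2 + b₁ ^ 2 = s ^ 2 + w ^ 2)
    (hab : a₀ * b₀ + a₁ * b₁ = r * s + t * w) :
    ∃ p q : ℝ, p ^ 2 + q ^ 2 = 1 ∧ p * a₁ - q * a₀ = r ∧ p * b₁ - q * b₀ = s := by
  have hA : r ^ 2 + t ^ 2 ≠ 0 := by positivity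
  have hcross : (a₀ * b₁ - a₁ * b₀) ^ 2 = (r * w - t * s) ^ 2 := by
    linear_combination (b₀ ^ 2 + b₁ ^ 2) * ha + (r ^ 2 + t ^ 2) * hb
      - (a₀ * b₀ + a₁ * b₁ + r * s + t * w) * hab
  obtain ⟨e, he, hc⟩ : ∃ e : ℝ, e ^ 2 = 1 ∧ a₀ * b₁ - a₁ * b₀ = e * (r * w - t * s) := by
    rcases sq_eq_sq_iff_eq_or_eq_neg.1 hcross with h | h
    · exact ⟨1, by norm_num, by linarith⟩
    · exact ⟨-1, by norm_num, by linarith⟩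
  refine ⟨(r * a₁ - e * t * a₀) / (r ^ 2 + t ^ 2), -(r * a₀ + e * t * a₁) / (r ^ 2 + t ^ 2),
    ?_, ?_, ?_⟩
  · field_simp
    linear_combination (r ^ 2 + e ^ 2 * t ^ 2) * ha + (r ^ 2 + t ^ 2) * t ^ 2 * he
  · field_simp
    linear_combination r * ha
  · field_simp
    linear_combination r * hab - e * t * hc - t * (r * w - t * s) * he

/-- Hart's Lemma 1 (Euclidean case): a point `P` lies on a common tangent line of two
non-overlapping circles if and only if the sum or the difference of the tangent lengths
from `P` to the two circles equals the length of a common (external or internal) tangent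
segment of the two circles. -/
theorem hart_lemma_one
    (O₁ O₂ P : EuclideanSpace ℝ (Fin 2)) (r₁ r₂ : ℝ)
    (hr₁ : 0 < r₁) (hr₂ : 0 < r₂)
    (hd : r₁ + r₂ < dist O₁ O₂)
    (hP₁ : r₁ ≤ dist P O₁) (hP₂ : r₂ ≤ dist P O₂) :
    (∃ ℓ : AffineSubspace ℝ (EuclideanSpace ℝ (Fin 2)),
        Module.finrank ℝ ℓ.direction = 1 ∧ P ∈ ℓ ∧
        Metric.infDist O₁ (ℓ : Set (EuclideanSpace ℝ (Fin 2))) = r₁ ∧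
        Metric.infDist O₂ (ℓ : Set (EuclideanSpace ℝ (Fin 2))) = r₂) ↔
      (Real.sqrt (dist P O₁ ^ 2 - r₁ ^ 2) + Real.sqrt (dist P O₂ ^ 2 - r₂ ^ 2)
          = Real.sqrt (dist O₁ O₂ ^ 2 - (r₁ - r₂) ^ 2) ∨
        Real.sqrt (dist P O₁ ^ 2 - r₁ ^ 2) + Real.sqrt (dist P O₂ ^ 2 - r₂ ^ 2)
          = Real.sqrt (dist O₁ O₂ ^ 2 - (r₁ + r₂) ^ 2) ∨
        |Real.sqrt (dist P O₁ ^ 2 - r₁ ^ 2) - Real.sqrt (dist P O₂ ^ 2 - r₂ ^ 2)|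
          = Real.sqrt (dist O₁ O₂ ^ 2 - (r₁ - r₂) ^ 2) ∨
        |Real.sqrt (dist P O₁ ^ 2 - r₁ ^ 2) - Real.sqrt (dist P O₂ ^ 2 - r₂ ^ 2)|
          = Real.sqrt (dist O₁ O₂ ^ 2 - (r₁ + r₂) ^ 2)) := by
  rw [exists_line_infDist_iff]
  have hd1 : dist P O₁ ^ 2 = (O₁ 0 - P 0) ^ 2 + (O₁ 1 - P 1) ^ 2 := by
    rw [dist_comm, EuclideanSpace.dist_sq_eq]
    simp [Fin.sum_univ_two, Real.dist_eq, sq_abs]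
  have hd2 : dist P O₂ ^ 2 = (O₂ 0 - P 0) ^ 2 + (O₂ 1 - P 1) ^ 2 := by
    rw [dist_comm, EuclideanSpace.dist_sq_eq]
    simp [Fin.sum_univ_two, Real.dist_eq, sq_abs]
  have hd12 : dist O₁ O₂ ^ 2 = ((O₁ 0 - P 0) - (O₂ 0 - P 0)) ^ 2
      + ((O₁ 1 - P 1) - (O₂ 1 - P 1)) ^ 2 := by
    rw [EuclideanSpace.dist_sq_eq]
    simp [Fin.sum_univ_two, Real.dist_eq, sq_abs]
  have ht1 : 0 ≤ dist P O₁ ^ 2 - r₁ ^ 2 := by nlinarith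
  have ht2 : 0 ≤ dist P O₂ ^ 2 - r₂ ^ 2 := by nlinarith
  have hext : 0 ≤ dist O₁ O₂ ^ 2 - (r₁ - r₂) ^ 2 := by nlinarith
  have hint : 0 ≤ dist O₁ O₂ ^ 2 - (r₁ + r₂) ^ 2 := by nlinarith
  have h1 := Real.sq_sqrt ht1
  have h2 := Real.sq_sqrt ht2
  have ht1' := Real.sqrt_nonneg (dist P O₁ ^ 2 - r₁ ^ 2)
  have ht2' := Real.sqrt_nonneg (dist P O₂ ^ 2 - r₂ ^ 2)
  have eq_iff : ∀ {x y : ℝ}, 0 ≤ x → 0 ≤ y → (x = √y ↔ x ^ 2 = y) := fun hx hy =>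
    ⟨fun h => by rw [h, Real.sq_sqrt hy], fun h => by rw [← h, Real.sqrt_sq hx]⟩
  rw [eq_iff (add_nonneg ht1' ht2') hext, eq_iff (add_nonneg ht1' ht2') hint,
    eq_iff (abs_nonneg _) hext, eq_iff (abs_nonneg _) hint, sq_abs]
  generalize √(dist P O₁ ^ 2 - r₁ ^ 2) = t₁ at *
  generalize √(dist P O₂ ^ 2 - r₂ ^ 2) = t₂ at *
  rw [hd1] at h1
  rw [hd2] at h2
  rw [hd12]
  generalize O₁ 0 - P 0 = a₀ at *
  generalize O₁ 1 - P 1 = a₁ at *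
  generalize O₂ 0 - P 0 = b₀ at *
  generalize O₂ 1 - P 1 = b₁ at *
  constructor
  · rintro ⟨p, q, hpq, ha, hb⟩
    have hrot (x y : ℝ) : (p * x + q * y) ^ 2 + (p * y - q * x) ^ 2 = x ^ 2 + y ^ 2 := by
      linear_combination (x ^ 2 + y ^ 2) * hpq
    have hda := hrot a₀ a₁
    have hdb := hrot b₀ b₁
    have hdab := hrot (a₀ - b₀) (a₁ - b₁)
    have ha2 : (p * a₁ - q * a₀) ^ 2 = r₁ ^ 2 := by rw [← ha, sq_abs]
    have hb2 : (p * b₁ - q * b₀) ^ 2 = r₂ ^ 2 := by rw [← hb, sq_abs]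
    have hta : (p * a₀ + q * a₁) ^ 2 = t₁ ^ 2 := by linarith
    have htb : (p * b₀ + q * b₁) ^ 2 = t₂ ^ 2 := by linarith
    have hsplit : ((p * a₀ + q * a₁) - (p * b₀ + q * b₁)) ^ 2
        + ((p * a₁ - q * a₀) - (p * b₁ - q * b₀)) ^ 2 = (a₀ - b₀) ^ 2 + (a₁ - b₁) ^ 2 := by
      rw [← hdab]; ring
    rw [← hsplit]
    rcases sq_eq_sq_iff_eq_or_eq_neg.1 ha2 with h3 | h3 <;>
    rcases sq_eq_sq_iff_eq_or_eq_neg.1 hb2 with h4 | h4 <;>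
    rcases sq_eq_sq_iff_eq_or_eq_neg.1 hta with h5 | h5 <;>
    rcases sq_eq_sq_iff_eq_or_eq_neg.1 htb with h6 | h6 <;>
    rw [h3, h4, h5, h6] <;>
    first
    | (left; ring1)
    | (right; left; ring1)
    | (right; right; left; ring1)
    | (right; right; right; ring1)
  · have of_inner {s w : ℝ} (hs : |s| = r₂) (hw : w ^ 2 = t₂ ^ 2)
        (h : (t₁ - w) ^ 2 = (a₀ - b₀) ^ 2 + (a₁ - b₁) ^ 2 - (r₁ - s) ^ 2) :
        ∃ p q : ℝ, p ^ 2 + q ^ 2 = 1 ∧ |p * a₁ - q * a₀| = r₁ ∧ |p * b₁ - q * b₀| = r₂ := by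
      have hs2 : s ^ 2 = r₂ ^ 2 := by rw [← hs, sq_abs]
      obtain ⟨p, q, hpq, ha, hb⟩ := exists_unit_cross_eq (a₀ := a₀) (a₁ := a₁) (b₀ := b₀)
        (b₁ := b₁) (r := r₁) (s := s) (t := t₁) (w := w) hr₁.ne' (by linarith) (by linarith)
        (by linarith)
      exact ⟨p, q, hpq, by rw [ha, abs_of_pos hr₁], by rw [hb, hs]⟩
    have hs : |r₂| = r₂ := abs_of_pos hr₂
    have hs' : |-r₂| = r₂ := by rw [abs_neg, hs]
    rintro (h | h | h | h)
    · exact of_inner (w := -t₂) hs (by ring) (by linarith)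
    · exact of_inner (w := -t₂) hs' (by ring) (by linarith)
    · exact of_inner (w := t₂) hs rfl h
    · exact of_inner (w := t₂) hs' rfl (by linarith)
end

section
/- Let (O₁, r₁) and (O₂, r₂) be two circles in the Euclidean plane E with r₁, r₂ > 0. Let ℓ be a line, let A ≠ B be points of ℓ with dist(A, O₁) = dist(B, O₁) = r₁, and let C ≠ D be points of ℓ with dist(C, O₂) = dist(D, O₂) = r₂, with A ≠ D and dist(A, B) = dist(C, D) (the two circles cut off chords of equal length from ℓ). Let P ∈ E be a point lying on the tangent line to the first circle at A and on the tangent line to the second circle at D, i.e., ⟪P − A, O₁ − A⟫ = 0 and ⟪P − D, O₂ − D⟫ = 0. Then the two circles subtend equal angles at P; equivalently, r₁ · dist(P, O₂) = r₂ · dist(P, O₁). -/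
open scoped RealInnerProductSpace

/-- The cross product of the vectors `u` and `v` of the Euclidean plane. -/
noncomputable def planeCross (u v : EuclideanSpace ℝ (Fin 2)) : ℝ :=
  u 0 * v 1 - u 1 * v 0

lemma real_inner_fin_two (u v : EuclideanSpace ℝ (Fin 2)) :
    ⟪u, v⟫ = u 0 * v 0 + u 1 * v 1 := by
  simp [PiLp.inner_apply, Fin.sum_univ_two, mul_comm]

lemma planeCross_sq_mul_norm_sq_of_inner_eq_zero {p o : EuclideanSpace ℝ (Fin 2)}
    (u : EuclideanSpace ℝ (Fin 2)) (h : ⟪p, o⟫ = 0) :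
    planeCross p u ^ 2 * ‖o‖ ^ 2 = ‖p‖ ^ 2 * ⟪o, u⟫ ^ 2 := by
  simp only [← real_inner_self_eq_norm_sq, real_inner_fin_two, planeCross] at h ⊢
  linear_combination ((u 0 * u 0 + u 1 * u 1) * (p 0 * o 0 + p 1 * o 1)
    - 2 * (o 0 * u 0 + o 1 * u 1) * (p 0 * u 0 + p 1 * u 1)) * h

/-- For a chord `AB` of a circle centered at `O` and a point `P` on the tangent at `A`, the
tangent length `PA` is determined by the radius, the chord length, and the distance from `P`
to the chord. -/
lemma planeCross_sq_mul_radius_sq_of_tangent {O A B P : EuclideanSpace ℝ (Fin 2)} {r : ℝ}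
    (hA : dist A O = r) (hB : dist B O = r) (hP : ⟪P - A, O - A⟫ = 0) :
    4 * planeCross (P - A) (B - A) ^ 2 * r ^ 2 = dist P A ^ 2 * dist A B ^ 4 := by
  have hchord : ⟪O - A, B - A⟫ = dist A B ^ 2 / 2 := by
    have h := norm_sub_sq_real (O - A) (B - A)
    rw [sub_sub_sub_cancel_right, ← dist_eq_norm, ← dist_eq_norm, ← dist_eq_norm,
      dist_comm O B, dist_comm O A, dist_comm B A, hA, hB] at h
    linarith
  have h := planeCross_sq_mul_norm_sq_of_inner_eq_zero (B - A) hP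
  rw [hchord, ← dist_eq_norm, ← dist_eq_norm, dist_comm O A, hA] at h
  linear_combination 4 * h

lemma dist_sq_of_tangent {O A P : EuclideanSpace ℝ (Fin 2)} {r : ℝ}
    (hA : dist A O = r) (hP : ⟪P - A, O - A⟫ = 0) :
    dist P O ^ 2 = dist P A ^ 2 + r ^ 2 := by
  have h := norm_sub_sq_real (P - A) (O - A)
  rw [sub_sub_sub_cancel_right, ← dist_eq_norm, ← dist_eq_norm, ← dist_eq_norm,
    dist_comm O A, hA, hP] at h
  linarith

/-- Chords `AB` and `CD` of equal length on a common line span triangles of equal area with any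
point. -/
lemma planeCross_sq_eq_of_dist_eq {A B C D : EuclideanSpace ℝ (Fin 2)}
    (P : EuclideanSpace ℝ (Fin 2)) {ℓ : AffineSubspace ℝ (EuclideanSpace ℝ (Fin 2))}
    (hℓ : Module.finrank ℝ ℓ.direction = 1)
    (hAl : A ∈ ℓ) (hBl : B ∈ ℓ) (hCl : C ∈ ℓ) (hDl : D ∈ ℓ)
    (hchord : dist A B = dist C D) :
    planeCross (P - A) (B - A) ^ 2 = planeCross (P - D) (C - D) ^ 2 := by
  obtain ⟨w, hw, hspan⟩ := finrank_eq_one_iff'.mp hℓ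
  have exists_smul {X Y : EuclideanSpace ℝ (Fin 2)} (hX : X ∈ ℓ) (hY : Y ∈ ℓ) :
      ∃ t : ℝ, t • (w : EuclideanSpace ℝ (Fin 2)) = X - Y := by
    obtain ⟨t, ht⟩ := hspan ⟨X - Y, AffineSubspace.vsub_mem_direction hX hY⟩
    exact ⟨t, congrArg Subtype.val ht⟩
  obtain ⟨s, hs⟩ := exists_smul hBl hAl
  obtain ⟨q, hq⟩ := exists_smul hCl hDl
  obtain ⟨t, ht⟩ := exists_smul hDl hAl
  have hsq : s ^ 2 = q ^ 2 := by
    rw [dist_comm, dist_eq_norm, dist_eq_norm, ← hs, ← hq, norm_smul, norm_smul] at hchord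
    exact sq_eq_sq_iff_abs_eq_abs _ _ |>.mpr
      (mul_right_cancel₀ (norm_ne_zero_iff.mpr (by simpa using hw)) hchord)
  have hPA : P - A = P - D + t • (w : EuclideanSpace ℝ (Fin 2)) := by rw [ht]; abel
  rw [hPA, ← hs, ← hq]
  simp only [planeCross, PiLp.add_apply, PiLp.smul_apply, smul_eq_mul]
  linear_combination
    ((P - D) 0 * (w : EuclideanSpace ℝ (Fin 2)) 1
      - (P - D) 1 * (w : EuclideanSpace ℝ (Fin 2)) 0) ^ 2 * hsq

/-- First assertion of Hart's Lemma 2: if two circles cut off equal-length chords `AB`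
and `CD` from a line `ℓ`, and the tangent line to the first circle at `A` meets the
tangent line to the second circle at `D` in a point `P`, then the two circles subtend
equal angles at `P`: `r₁ / dist P O₁ = r₂ / dist P O₂`, i.e.
`r₁ * dist P O₂ = r₂ * dist P O₁`. -/
theorem hart_lemma_two_angles
    (O₁ O₂ A B C D P : EuclideanSpace ℝ (Fin 2)) (r₁ r₂ : ℝ)
    (hr₁ : 0 < r₁) (hr₂ : 0 < r₂)
    (ℓ : AffineSubspace ℝ (EuclideanSpace ℝ (Fin 2)))
    (hℓ : Module.finrank ℝ ℓ.direction = 1)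
    (hAl : A ∈ ℓ) (hBl : B ∈ ℓ) (hCl : C ∈ ℓ) (hDl : D ∈ ℓ)
    (hAB : A ≠ B) (hCD : C ≠ D) (hAD : A ≠ D)
    (hA : dist A O₁ = r₁) (hB : dist B O₁ = r₁)
    (hC : dist C O₂ = r₂) (hD : dist D O₂ = r₂)
    (hchord : dist A B = dist C D)
    (hPA : ⟪P - A, O₁ - A⟫ = 0) (hPD : ⟪P - D, O₂ - D⟫ = 0) :
    r₁ * dist P O₂ = r₂ * dist P O₁ := by
  have h₁ := planeCross_sq_mul_radius_sq_of_tangent hA hB hPA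
  have h₂ := planeCross_sq_mul_radius_sq_of_tangent hD hC hPD
  rw [planeCross_sq_eq_of_dist_eq P hℓ hAl hBl hCl hDl hchord] at h₁
  rw [dist_comm D C, ← hchord] at h₂
  have htangent : r₁ ^ 2 * dist P D ^ 2 = r₂ ^ 2 * dist P A ^ 2 :=
    mul_right_cancel₀ (pow_ne_zero 4 (dist_ne_zero.mpr hAB))
      (by linear_combination r₂ ^ 2 * h₁ - r₁ ^ 2 * h₂)
  rw [← sq_eq_sq₀ (by positivity) (by positivity), mul_pow, mul_pow,
    dist_sq_of_tangent hA hPA, dist_sq_of_tangent hD hPD]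
  linear_combination htangent
end

section
/- Let s > 0 and let l, η, ζ be real numbers. Then the first of Schellbach's main equations, cosh l · cosh η · cosh ζ / cosh(s/2) + sinh l · sinh η · sinh ζ / sinh(s/2) = 1, holds if and only if cosh(η + ζ) · sinh(s/2 + l) + cosh(η − ζ) · sinh(s/2 − l) = sinh s. -/
/-- Product-to-sum reformulation of the first of Schellbach's main equations (ME1). -/
theorem schellbach_main_iff
    (s l η ζ : ℝ) (hs : 0 < s) :
    (Real.cosh l * Real.cosh η * Real.cosh ζ / Real.cosh (s / 2)
        + Real.sinh l * Real.sinh η * Real.sinh ζ / Real.sinh (s / 2) = 1) ↔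
      Real.cosh (η + ζ) * Real.sinh (s / 2 + l) + Real.cosh (η - ζ) * Real.sinh (s / 2 - l)
        = Real.sinh s := by
  have hC : Real.cosh (s / 2) ≠ 0 := (Real.cosh_pos _).ne'
  have hS : Real.sinh (s / 2) ≠ 0 := (Real.sinh_pos_iff.mpr (half_pos hs)).ne'
  have hdouble : Real.sinh s = 2 * Real.sinh (s / 2) * Real.cosh (s / 2) := by
    rw [← Real.sinh_two_mul, mul_div_cancel₀ s two_ne_zero]
  rw [hdouble, Real.cosh_add, Real.cosh_sub, Real.sinh_add, Real.sinh_sub,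
    div_add_div _ _ hC hS, div_eq_one_iff_eq (mul_ne_zero hC hS)]
  constructor <;> intro h <;> linarith
end

section
/- Let s > 0 and let l, λ, η, ζ be real numbers such that cosh(η + ζ) = cosh((s + λ − l)/2) / cosh((λ + l)/2) and cosh(η − ζ) = cosh((s − λ + l)/2) / cosh((λ + l)/2). Then the first of Schellbach's main equations holds: cosh l · cosh η · cosh ζ / cosh(s/2) + sinh l · sinh η · sinh ζ / sinh(s/2) = 1. -/
/-- Schellbach's formulas for `cosh (η ± ζ)` in terms of the subsidiary angle `λ`
satisfy the first main equation (ME1). -/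
theorem schellbach_formulas_satisfy_main
    (s l lam η ζ : ℝ) (hs : 0 < s)
    (hsum : Real.cosh (η + ζ) = Real.cosh ((s + lam - l) / 2) / Real.cosh ((lam + l) / 2))
    (hdiff : Real.cosh (η - ζ) = Real.cosh ((s - lam + l) / 2) / Real.cosh ((lam + l) / 2)) :
    Real.cosh l * Real.cosh η * Real.cosh ζ / Real.cosh (s / 2)
      + Real.sinh l * Real.sinh η * Real.sinh ζ / Real.sinh (s / 2) = 1 := by
  set p := (lam - l) / 2 with hp
  set q := (lam + l) / 2 with hq
  have hcosh_s : Real.cosh (s / 2) ≠ 0 := (Real.cosh_pos _).ne'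
  have hsinh_s : Real.sinh (s / 2) ≠ 0 := (Real.sinh_pos_iff.2 (half_pos hs)).ne'
  have hcosh_q : Real.cosh q ≠ 0 := (Real.cosh_pos _).ne'
  rw [show (s + lam - l) / 2 = s / 2 + p by rw [hp]; ring, eq_div_iff hcosh_q,
    Real.cosh_add, Real.cosh_add] at hsum
  rw [show (s - lam + l) / 2 = s / 2 - p by rw [hp]; ring, eq_div_iff hcosh_q,
    Real.cosh_sub, Real.cosh_sub] at hdiff
  have hcc : Real.cosh η * Real.cosh ζ = Real.cosh (s / 2) * Real.cosh p / Real.cosh q := by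
    rw [eq_div_iff hcosh_q]
    linarith
  have hss : Real.sinh η * Real.sinh ζ = Real.sinh (s / 2) * Real.sinh p / Real.cosh q := by
    rw [eq_div_iff hcosh_q]
    linarith
  have hadd : Real.cosh q = Real.cosh l * Real.cosh p + Real.sinh l * Real.sinh p := by
    rw [← Real.cosh_add, show l + p = q by rw [hp, hq]; ring]
  rw [mul_assoc, mul_assoc, hcc, hss]
  field_simp
  exact hadd.symm
end

section
/- Let s > 0 and let l, m, n be real numbers with l + m + n = s/2, and suppose ξ, η, ζ > 0 satisfy Schellbach's main system: (ME1) cosh l cosh η cosh ζ / cosh(s/2) + sinh l sinh η sinh ζ / sinh(s/2) = 1, (ME2) cosh m cosh ζ cosh ξ / cosh(s/2) + sinh m sinh ζ sinh ξ / sinh(s/2) = 1, (ME3) cosh n cosh ξ cosh η / cosh(s/2) + sinh n sinh ξ sinh η / sinh(s/2) = 1. Then there exist real numbers λ, μ, ν satisfying the subsidiary equations (AE1) cosh λ cosh m cosh n / cosh(s/2) − sinh λ sinh m sinh n / sinh(s/2) = 1, (AE2) cosh μ cosh n cosh l / cosh(s/2) − sinh μ sinh n sinh l / sinh(s/2) =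 1, (AE3) cosh ν cosh l cosh m / cosh(s/2) − sinh ν sinh l sinh m / sinh(s/2) = 1, such that cosh(η + ζ) = cosh((s + λ − l)/2)/cosh((λ + l)/2), cosh(η − ζ) = cosh((s − λ + l)/2)/cosh((λ + l)/2), cosh(ζ + ξ) = cosh((s + μ − m)/2)/cosh((μ + m)/2), cosh(ζ − ξ) = cosh((s − μ + m)/2)/cosh((μ + m)/2), cosh(ξ + η) = cosh((s + ν − n)/2)/cosh((ν + n)/2), and cosh(ξ − η) = cosh((s − ν + n)/2)/cosh((ν + n)/2). -/
section

open Real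

/-- Three angles whose hyperbolic tangents are bounded in terms of `tanh σ`, one of them being
negative, have sum at most `σ`. -/
theorem add_add_le_of_tanh_eq_neg {σ w₁ w₂ w₃ q r : ℝ} (hσ : 0 < σ) (hq₀ : 0 ≤ q) (hq₁ : q ≤ 1)
    (hr₀ : 0 ≤ r) (hr₁ : r ≤ 1) (h₁ : tanh w₁ = -(tanh σ * (q * r)))
    (h₂ : tanh w₂ ≤ tanh σ * r) (h₃ : tanh w₃ ≤ tanh σ * q) : w₁ + w₂ + w₃ ≤ σ := by
  have expand : sinh (σ - (w₁ + w₂ + w₃)) = cosh σ * cosh w₁ * cosh w₂ * cosh w₃ *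
      ((tanh σ - tanh w₁) * (1 + tanh w₂ * tanh w₃)
        - (1 - tanh σ * tanh w₁) * (tanh w₂ + tanh w₃)) := by
    have h := fun x => (cosh_pos x).ne'
    have hσ := h σ
    have hw₁ := h w₁
    have hw₂ := h w₂
    have hw₃ := h w₃
    rw [sinh_sub, sinh_add, cosh_add, sinh_add, cosh_add]
    simp only [tanh_eq_sinh_div_cosh]
    field_simp
    ring
  have hT₀ : 0 < tanh σ := by
    rw [tanh_eq_sinh_div_cosh]
    exact div_pos (sinh_pos_iff.2 hσ) (cosh_pos σ)
  have hT₁ := tanh_lt_one σ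
  rw [h₁] at expand
  generalize tanh σ = T at *
  generalize tanh w₂ = t₂ at *
  generalize tanh w₃ = t₃ at *
  have hT2 : T ^ 2 ≤ 1 := by nlinarith
  have coeff : ∀ x y : ℝ, 0 ≤ x → x ≤ 1 → 0 ≤ y → y ≤ 1 →
      0 ≤ 1 + T ^ 2 * (x * y) - T * (1 + x * y) * (T * x) := by
    intro x y hx₀ hx₁ hy₀ hy₁
    have e₁ : T ^ 2 * x ≤ 1 := by nlinarith
    have e₂ : 0 ≤ T ^ 2 * (x * y) * (1 - x) :=
      mul_nonneg (by positivity) (sub_nonneg.2 hx₁)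
    nlinarith
  have c₃ := coeff q r hq₀ hq₁ hr₀ hr₁
  have c₂ := coeff r q hr₀ hr₁ hq₀ hq₁
  have d₃ : 0 ≤ 1 + T ^ 2 * (q * r) - T * (1 + q * r) * t₃ := by
    have : T * (1 + q * r) * t₃ ≤ T * (1 + q * r) * (T * q) :=
      mul_le_mul_of_nonneg_left h₃ (by positivity)
    linarith
  have e : 0 ≤ (1 + T ^ 2 * (q * r)) * T * ((1 - q) * (1 - r)) :=
    mul_nonneg (by positivity) (mul_nonneg (sub_nonneg.2 hq₁) (sub_nonneg.2 hr₁))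
  have key : 0 ≤ (T - -(T * (q * r))) * (1 + t₂ * t₃) - (1 - T * -(T * (q * r))) * (t₂ + t₃) := by
    linear_combination e + mul_nonneg d₃ (sub_nonneg.2 h₂) + mul_nonneg c₂ (sub_nonneg.2 h₃)
  have hpos : 0 ≤ sinh (σ - (w₁ + w₂ + w₃)) := by
    rw [expand]
    have := cosh_pos
    exact mul_nonneg (mul_pos (mul_pos (mul_pos (this _) (this _)) (this _)) (this _)).le key
  linarith [sinh_nonneg_iff.1 hpos]

/-- The polynomial identity behind the subsidiary equations. -/
theorem malfatti_identity {C S c₁ c₂ c₃ s₁ s₂ s₃ P Q R : ℝ}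
    (hC : C ^ 2 = 1 + S ^ 2) (h₁ : c₁ ^ 2 = 1 + s₁ ^ 2) (h₂ : c₂ ^ 2 = 1 + s₂ ^ 2)
    (h₃ : c₃ ^ 2 = 1 + s₃ ^ 2) (hP : P ^ 2 = S ^ 2 - s₁ ^ 2) (hQ : Q ^ 2 = S ^ 2 - s₂ ^ 2)
    (hR : R ^ 2 = S ^ 2 - s₃ ^ 2) :
    C ^ 2 * ((S ^ 2 * (c₂ * c₃) + s₂ * s₃ * (Q * R)) * (S ^ 2 * (c₃ * c₁) - s₃ * s₁ * (R * P))
          * (S ^ 2 * (c₁ * c₂) - s₁ * s₂ * (P * Q)))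
      - S ^ 2 * ((c₂ * c₃ * (Q * R) + C ^ 2 * (s₂ * s₃))
          * (c₃ * c₁ * (R * P) - C ^ 2 * (s₃ * s₁)) * (c₁ * c₂ * (P * Q) - C ^ 2 * (s₁ * s₂)))
      = (S ^ 2 * (1 + s₂ ^ 2 + s₃ ^ 2) - s₂ ^ 2 * s₃ ^ 2)
        * (S ^ 2 * (1 + s₃ ^ 2 + s₁ ^ 2) - s₃ ^ 2 * s₁ ^ 2)
        * (S ^ 2 * (1 + s₁ ^ 2 + s₂ ^ 2) - s₁ ^ 2 * s₂ ^ 2) := by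
  have split :
      C ^ 2 * ((S ^ 2 * (c₂ * c₃) + s₂ * s₃ * (Q * R)) * (S ^ 2 * (c₃ * c₁) - s₃ * s₁ * (R * P))
          * (S ^ 2 * (c₁ * c₂) - s₁ * s₂ * (P * Q)))
      - S ^ 2 * ((c₂ * c₃ * (Q * R) + C ^ 2 * (s₂ * s₃))
          * (c₃ * c₁ * (R * P) - C ^ 2 * (s₃ * s₁)) * (c₁ * c₂ * (P * Q) - C ^ 2 * (s₁ * s₂)))
      = C ^ 2 * ((S ^ 2) ^ 3 * (c₁ ^ 2 * c₂ ^ 2 * c₃ ^ 2)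
          + s₁ ^ 2 * s₂ ^ 2 * s₃ ^ 2 * (P ^ 2 * Q ^ 2 * R ^ 2))
        - S ^ 2 * (c₁ ^ 2 * c₂ ^ 2 * c₃ ^ 2 * (P ^ 2 * Q ^ 2 * R ^ 2)
          + (C ^ 2) ^ 3 * (s₁ ^ 2 * s₂ ^ 2 * s₃ ^ 2))
        + C ^ 2 * S ^ 2 * (c₂ * s₂ * Q * (c₃ * s₃ * R)
              * (s₁ ^ 2 * P ^ 2 + S ^ 2 * c₁ ^ 2 - C ^ 2 * s₁ ^ 2 - c₁ ^ 2 * P ^ 2)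
            - c₃ * s₃ * R * (c₁ * s₁ * P)
              * (s₂ ^ 2 * Q ^ 2 + S ^ 2 * c₂ ^ 2 - C ^ 2 * s₂ ^ 2 - c₂ ^ 2 * Q ^ 2)
            - c₁ * s₁ * P * (c₂ * s₂ * Q)
              * (s₃ ^ 2 * R ^ 2 + S ^ 2 * c₃ ^ 2 - C ^ 2 * s₃ ^ 2 - c₃ ^ 2 * R ^ 2)) := by
    ring
  rw [split, hC, h₁, h₂, h₃, hP, hQ, hR]
  ring


theorem neg_of_main_equation {σ l y z : ℝ} (hσ : 0 < σ) (hy : σ ≤ y) (hz : σ ≤ z)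
    (h : cosh l * cosh y * cosh z / cosh σ + sinh l * sinh y * sinh z / sinh σ = 1) :
    l < 0 := by
  by_contra! hl
  have hS : 0 < sinh σ := sinh_pos_iff.2 hσ
  have hC : 1 < cosh σ := one_lt_cosh.2 hσ.ne'
  have hy' : cosh σ ≤ cosh y := cosh_le_cosh.2 (abs_le_abs_of_nonneg hσ.le hy)
  have hz' : cosh σ ≤ cosh z := cosh_le_cosh.2 (abs_le_abs_of_nonneg hσ.le hz)
  have h₁ : 0 ≤ sinh l * sinh y * sinh z / sinh σ :=
    div_nonneg (mul_nonneg (mul_nonneg (sinh_nonneg_iff.2 hl)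
      (sinh_nonneg_iff.2 (hσ.le.trans hy))) (sinh_nonneg_iff.2 (hσ.le.trans hz))) hS.le
  have h₂ : 1 < cosh l * cosh y * cosh z / cosh σ := by
    rw [one_lt_div (by positivity)]
    have := one_le_cosh l
    calc cosh σ < 1 * cosh σ * cosh σ := by nlinarith
      _ ≤ cosh l * cosh y * cosh z := by gcongr
  linarith

theorem main_equation_mul {σ l y z : ℝ} (hσ : 0 < σ)
    (h : cosh l * cosh y * cosh z / cosh σ + sinh l * sinh y * sinh z / sinh σ = 1) :
    cosh l * (sinh σ * (cosh y * cosh z)) + sinh l * (cosh σ * (sinh y * sinh z))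
      = cosh σ * sinh σ := by
  have hS : sinh σ ≠ 0 := (sinh_pos_iff.2 hσ).ne'
  have hC : cosh σ ≠ 0 := (cosh_pos σ).ne'
  field_simp at h
  linarith

theorem main_equation_sq {σ l y z : ℝ} (hσ : 0 < σ)
    (h : cosh l * cosh y * cosh z / cosh σ + sinh l * sinh y * sinh z / sinh σ = 1) :
    (sinh l * (sinh σ * (cosh y * cosh z)) + cosh l * (cosh σ * (sinh y * sinh z))) ^ 2
      = (sinh σ ^ 2 - sinh y ^ 2) * (sinh σ ^ 2 - sinh z ^ 2) := by
  have h' := congrArg (· ^ 2) (main_equation_mul hσ h)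
  simp only [add_sq, mul_pow, cosh_sq] at h' ⊢
  linear_combination h'

theorem sinh_le_sinh_of_main_equations {σ l m n x y z : ℝ} (hσ : 0 < σ)
    (hlmn : l + m + n = σ) (hy : 0 < y) (hz : 0 < z)
    (h₁ : cosh l * cosh y * cosh z / cosh σ + sinh l * sinh y * sinh z / sinh σ = 1)
    (h₂ : cosh m * cosh z * cosh x / cosh σ + sinh m * sinh z * sinh x / sinh σ = 1)
    (h₃ : cosh n * cosh x * cosh y / cosh σ + sinh n * sinh x * sinh y / sinh σ = 1) :
    sinh x ≤ sinh σ := by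
  by_contra! hlt
  have hS : 0 < sinh σ := sinh_pos_iff.2 hσ
  have hneg : sinh σ ^ 2 - sinh x ^ 2 < 0 := by nlinarith
  have large : ∀ t, 0 < t → 0 ≤ (sinh σ ^ 2 - sinh x ^ 2) * (sinh σ ^ 2 - sinh t ^ 2) →
      σ ≤ t := by
    intro t ht h
    have ht' : 0 < sinh t := sinh_pos_iff.2 ht
    rw [← sinh_le_sinh]
    have : sinh σ ^ 2 - sinh t ^ 2 ≤ 0 := by nlinarith
    nlinarith
  have hxσ : σ ≤ x := (sinh_lt_sinh.1 hlt).le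
  have hyσ : σ ≤ y := large y hy (main_equation_sq hσ h₃ ▸ sq_nonneg _)
  have hzσ : σ ≤ z := large z hz (by rw [mul_comm, ← main_equation_sq hσ h₂]; exact sq_nonneg _)
  linarith [neg_of_main_equation hσ hyσ hzσ h₁, neg_of_main_equation hσ hzσ hxσ h₂,
    neg_of_main_equation hσ hxσ hyσ h₃]

theorem malfatti_denom_pos {S p q : ℝ} (hS : 0 < S) (hp : 0 ≤ p) (hpS : p ≤ S) :
    0 < S ^ 2 * (1 + p ^ 2 + q ^ 2) - p ^ 2 * q ^ 2 := by
  have : p ^ 2 ≤ S ^ 2 := by gcongr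
  have := mul_nonneg (sq_nonneg q) (sub_nonneg.2 this)
  have : 0 < S ^ 2 := by positivity
  have : 0 ≤ S ^ 2 * p ^ 2 := by positivity
  nlinarith

theorem exists_sq_eq_sub_sq {a b : ℝ} (hb : 0 ≤ b) (hba : b ≤ a) :
    ∃ P : ℝ, 0 ≤ P ∧ P ≤ a ∧ P ^ 2 = a ^ 2 - b ^ 2 :=
  ⟨√(a ^ 2 - b ^ 2), sqrt_nonneg _, sqrt_le_iff.2 ⟨hb.trans hba, by nlinarith⟩,
    sq_sqrt (by nlinarith)⟩

/-- Solution of a single main equation by means of the angle `u = (λ - l) / 2`. -/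
theorem exists_angle_of_main_equation {σ l y z : ℝ} (hσ : 0 < σ) (hy : 0 < y) (hz : 0 < z)
    (hyσ : sinh y ≤ sinh σ)
    (h : cosh l * cosh y * cosh z / cosh σ + sinh l * sinh y * sinh z / sinh σ = 1) :
    ∃ u K : ℝ, 0 < u ∧ tanh (l + u) = K / (cosh σ * sinh σ) ∧
      K ^ 2 = (sinh σ ^ 2 - sinh y ^ 2) * (sinh σ ^ 2 - sinh z ^ 2) ∧
      cosh (y + z) = cosh (σ + u) / cosh (l + u) ∧
      cosh (y - z) = cosh (σ - u) / cosh (l + u) ∧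
      (sinh σ ^ 2 * (1 + sinh y ^ 2 + sinh z ^ 2) - sinh y ^ 2 * sinh z ^ 2) * cosh l
        = cosh σ * (sinh σ ^ 2 * (cosh y * cosh z) - sinh y * sinh z * K) ∧
      (sinh σ ^ 2 * (1 + sinh y ^ 2 + sinh z ^ 2) - sinh y ^ 2 * sinh z ^ 2) * sinh l
        = sinh σ * (cosh y * cosh z * K - cosh σ ^ 2 * (sinh y * sinh z)) ∧
      (sinh σ ^ 2 * (1 + sinh y ^ 2 + sinh z ^ 2) - sinh y ^ 2 * sinh z ^ 2) * cosh (l + 2 * u)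
        = cosh σ * (sinh σ ^ 2 * (cosh y * cosh z) + sinh y * sinh z * K) ∧
      (sinh σ ^ 2 * (1 + sinh y ^ 2 + sinh z ^ 2) - sinh y ^ 2 * sinh z ^ 2) * sinh (l + 2 * u)
        = sinh σ * (cosh y * cosh z * K + cosh σ ^ 2 * (sinh y * sinh z)) := by
  have hS : 0 < sinh σ := sinh_pos_iff.2 hσ
  have hC : 0 < cosh σ := cosh_pos σ
  have hsy : 0 < sinh y := sinh_pos_iff.2 hy
  have hsz : 0 < sinh z := sinh_pos_iff.2 hz
  have hδ := malfatti_denom_pos (q := sinh z) hS hsy.le hyσ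
  set δ := sinh σ ^ 2 * (1 + sinh y ^ 2 + sinh z ^ 2) - sinh y ^ 2 * sinh z ^ 2 with hδ_def
  obtain ⟨A, hA⟩ : ∃ A, A = sinh σ * (cosh y * cosh z) := ⟨_, rfl⟩
  obtain ⟨B, hB⟩ : ∃ B, B = cosh σ * (sinh y * sinh z) := ⟨_, rfl⟩
  have hA₀ : 0 < A := by rw [hA]; positivity
  have hB₀ : 0 < B := by rw [hB]; positivity
  have hAB : A ^ 2 - B ^ 2 = δ := by
    rw [hA, hB, hδ_def]
    simp only [mul_pow, cosh_sq]
    ring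
  have hBA : B < A := by nlinarith
  have hmain := main_equation_mul hσ h
  have hsq := main_equation_sq hσ h
  rw [← hA, ← hB] at hmain hsq
  obtain ⟨K, hK⟩ : ∃ K, K = sinh l * A + cosh l * B := ⟨_, rfl⟩
  rw [← hK] at hsq
  obtain ⟨u, hu⟩ : ∃ u, tanh u = B / A :=
    ⟨_, tanh_artanh ⟨by linarith [div_pos hB₀ hA₀], (div_lt_one hA₀).2 hBA⟩⟩
  obtain ⟨ρ, hρ⟩ : ∃ ρ, ρ = cosh u / A := ⟨_, rfl⟩
  have hρ₀ : 0 < ρ := by rw [hρ]; exact div_pos (cosh_pos u) hA₀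
  have hcu : cosh u = ρ * A := by rw [hρ]; field_simp
  have hsu : sinh u = ρ * B := by
    have := (cosh_pos u).ne'
    rw [tanh_eq_sinh_div_cosh] at hu
    field_simp at hu
    rw [hρ]
    field_simp
    linarith
  have hρδ : ρ ^ 2 * δ = 1 := by
    have := cosh_sq u
    rw [hcu, hsu] at this
    rw [← hAB]
    linear_combination this
  have hclu : cosh (l + u) = ρ * (cosh σ * sinh σ) := by
    rw [cosh_add, hcu, hsu, ← hmain]
    ring
  have hslu : sinh (l + u) = ρ * K := by
    rw [sinh_add, hcu, hsu, hK]
    ring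
  have h2u : l + 2 * u = l + u + u := by ring
  refine ⟨u, K, ?_, ?_, hsq, ?_, ?_, ?_, ?_, ?_, ?_⟩
  · rw [← sinh_pos_iff, hsu]
    positivity
  · rw [tanh_eq_sinh_div_cosh, hclu, hslu, mul_div_mul_left _ _ hρ₀.ne']
  · rw [eq_div_iff (cosh_pos _).ne', hclu, cosh_add, cosh_add, hcu, hsu, hA, hB]
    ring
  · rw [eq_div_iff (cosh_pos _).ne', hclu, cosh_sub, cosh_sub, hcu, hsu, hA, hB]
    ring
  · have : δ * cosh l = A * (cosh σ * sinh σ) - B * K := by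
      rw [← hAB, ← hmain, hK]; ring
    rw [this, hA, hB]; ring
  · have : δ * sinh l = A * K - B * (cosh σ * sinh σ) := by
      rw [← hAB, ← hmain, hK]; ring
    rw [this, hA, hB]; ring
  · have : δ * cosh (l + 2 * u) = ρ ^ 2 * δ * (A * (cosh σ * sinh σ) + B * K) := by
      rw [h2u, cosh_add, hclu, hslu, hcu, hsu]; ring
    rw [this, hρδ, hA, hB]; ring
  · have : δ * sinh (l + 2 * u) = ρ ^ 2 * δ * (A * K + B * (cosh σ * sinh σ)) := by
      rw [h2u, sinh_add, hclu, hslu, hcu, hsu]; ring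
    rw [this, hρδ, hA, hB]; ring

/-- The angle sum condition selects the nonnegative root in the solution of a main equation. -/
theorem eq_mul_of_tanh_eq {σ w₁ w₂ w₃ K₁ K₂ K₃ P Q R : ℝ} (hσ : 0 < σ) (hw : σ < w₁ + w₂ + w₃)
    (hP : 0 ≤ P) (hQ : 0 ≤ Q) (hR : 0 ≤ R) (hPS : P ≤ sinh σ) (hQS : Q ≤ sinh σ)
    (hRS : R ≤ sinh σ) (hw₁ : tanh w₁ = K₁ / (cosh σ * sinh σ))
    (hw₂ : tanh w₂ = K₂ / (cosh σ * sinh σ)) (hw₃ : tanh w₃ = K₃ / (cosh σ * sinh σ))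
    (hK₁ : K₁ ^ 2 = (Q * R) ^ 2) (hK₂ : K₂ ^ 2 = (R * P) ^ 2) (hK₃ : K₃ ^ 2 = (P * Q) ^ 2) :
    K₁ = Q * R := by
  have hS : 0 < sinh σ := sinh_pos_iff.2 hσ
  have hC : 0 < cosh σ := cosh_pos σ
  refine (sq_eq_sq_iff_eq_or_eq_neg.1 hK₁).resolve_right fun hneg => hw.not_ge ?_
  have bound : ∀ K X, 0 ≤ X → K ^ 2 = (X * P) ^ 2 →
      K / (cosh σ * sinh σ) ≤ tanh σ * (X / sinh σ) := by
    intro K X hX hK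
    have h₁ : K ≤ X * P := (le_abs_self K).trans (abs_le_of_sq_le_sq hK.le (by positivity))
    have h₂ : K ≤ X * sinh σ := h₁.trans (by gcongr)
    rw [tanh_eq_sinh_div_cosh, div_mul_div_comm, div_le_div_iff_of_pos_right (by positivity)]
    linarith
  refine add_add_le_of_tanh_eq_neg (q := Q / sinh σ) (r := R / sinh σ) hσ (by positivity)
    ((div_le_one hS).2 hQS) (by positivity) ((div_le_one hS).2 hRS) ?_ ?_ ?_
  · rw [hw₁, hneg, tanh_eq_sinh_div_cosh]
    field_simp
  · exact hw₂ ▸ bound K₂ R hR hK₂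
  · exact hw₃ ▸ bound K₃ Q hQ (by rw [hK₃, mul_comm])

/-- A subsidiary equation follows from the closed forms of its hyperbolic functions. -/
theorem subsidiary_equation {C S a b c d e f D₁ D₂ D₃ A₁ A₂ A₃ B₁ B₂ B₃ : ℝ}
    (hD₁ : D₁ ≠ 0) (hD₂ : D₂ ≠ 0) (hD₃ : D₃ ≠ 0)
    (ha : D₁ * a = C * A₁) (hb : D₂ * b = C * A₂) (hc : D₃ * c = C * A₃)
    (hd : D₁ * d = S * B₁) (he : D₂ * e = S * B₂) (hf : D₃ * f = S * B₃)
    (h : C ^ 2 * (A₁ * A₂ * A₃) - S ^ 2 * (B₁ * B₂ * B₃) = D₁ * D₂ * D₃) :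
    a * b * c / C - d * e * f / S = 1 := by
  rw [mul_comm, ← eq_div_iff hD₁] at ha hd
  rw [mul_comm, ← eq_div_iff hD₂] at hb he
  rw [mul_comm, ← eq_div_iff hD₃] at hc hf
  subst ha hb hc hd he hf
  field_simp
  linear_combination h

end


/-- Schellbach's solution of the main system: if `ξ, η, ζ > 0` satisfy the main
equations (ME1)–(ME3), then there are subsidiary angles `λ, μ, ν` satisfying the
subsidiary equations (AE1)–(AE3) and such that the displayed formulas for
`cosh (η ± ζ)`, `cosh (ζ ± ξ)`, `cosh (ξ ± η)` hold. -/
theorem schellbach_solution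
    (s l m n ξ η ζ : ℝ) (hs : 0 < s) (hlmn : l + m + n = s / 2)
    (hξ : 0 < ξ) (hη : 0 < η) (hζ : 0 < ζ)
    (hME1 : Real.cosh l * Real.cosh η * Real.cosh ζ / Real.cosh (s / 2)
        + Real.sinh l * Real.sinh η * Real.sinh ζ / Real.sinh (s / 2) = 1)
    (hME2 : Real.cosh m * Real.cosh ζ * Real.cosh ξ / Real.cosh (s / 2)
        + Real.sinh m * Real.sinh ζ * Real.sinh ξ / Real.sinh (s / 2) = 1)
    (hME3 : Real.cosh n * Real.cosh ξ * Real.cosh η / Real.cosh (s / 2)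
        + Real.sinh n * Real.sinh ξ * Real.sinh η / Real.sinh (s / 2) = 1) :
    ∃ lam μ ν : ℝ,
      (Real.cosh lam * Real.cosh m * Real.cosh n / Real.cosh (s / 2)
          - Real.sinh lam * Real.sinh m * Real.sinh n / Real.sinh (s / 2) = 1) ∧
      (Real.cosh μ * Real.cosh n * Real.cosh l / Real.cosh (s / 2)
          - Real.sinh μ * Real.sinh n * Real.sinh l / Real.sinh (s / 2) = 1) ∧
      (Real.cosh ν * Real.cosh l * Real.cosh m / Real.cosh (s / 2)
          - Real.sinh ν * Real.sinh l * Real.sinh m / Real.sinh (s / 2) = 1) ∧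
      Real.cosh (η + ζ) = Real.cosh ((s + lam - l) / 2) / Real.cosh ((lam + l) / 2) ∧
      Real.cosh (η - ζ) = Real.cosh ((s - lam + l) / 2) / Real.cosh ((lam + l) / 2) ∧
      Real.cosh (ζ + ξ) = Real.cosh ((s + μ - m) / 2) / Real.cosh ((μ + m) / 2) ∧
      Real.cosh (ζ - ξ) = Real.cosh ((s - μ + m) / 2) / Real.cosh ((μ + m) / 2) ∧
      Real.cosh (ξ + η) = Real.cosh ((s + ν - n) / 2) / Real.cosh ((ν + n) / 2) ∧
      Real.cosh (ξ - η) = Real.cosh ((s - ν + n) / 2) / Real.cosh ((ν + n) / 2) := by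
  obtain ⟨σ, rfl⟩ : ∃ σ, s = 2 * σ := ⟨s / 2, by ring⟩
  rw [mul_div_cancel_left₀ σ two_ne_zero] at *
  replace hs : 0 < σ := by linarith
  have hS : 0 < Real.sinh σ := Real.sinh_pos_iff.2 hs
  have hxS := sinh_le_sinh_of_main_equations hs hlmn hη hζ hME1 hME2 hME3
  have hyS := sinh_le_sinh_of_main_equations hs (by linarith) hζ hξ hME2 hME3 hME1
  have hzS := sinh_le_sinh_of_main_equations hs (by linarith) hξ hη hME3 hME1 hME2
  obtain ⟨u₁, K₁, hu₁, ht₁, hK₁, hp₁, hm₁, hcl, hsl, hcL, hsL⟩ :=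
    exists_angle_of_main_equation hs hη hζ hyS hME1
  obtain ⟨u₂, K₂, hu₂, ht₂, hK₂, hp₂, hm₂, hcm, hsm, hcM, hsM⟩ :=
    exists_angle_of_main_equation hs hζ hξ hzS hME2
  obtain ⟨u₃, K₃, hu₃, ht₃, hK₃, hp₃, hm₃, hcn, hsn, hcN, hsN⟩ :=
    exists_angle_of_main_equation hs hξ hη hxS hME3
  obtain ⟨P, hP₀, hPS, hP⟩ := exists_sq_eq_sub_sq (Real.sinh_nonneg_iff.2 hξ.le) hxS
  obtain ⟨Q, hQ₀, hQS, hQ⟩ := exists_sq_eq_sub_sq (Real.sinh_nonneg_iff.2 hη.le) hyS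
  obtain ⟨R, hR₀, hRS, hR⟩ := exists_sq_eq_sub_sq (Real.sinh_nonneg_iff.2 hζ.le) hzS
  rw [← hQ, ← hR, ← mul_pow] at hK₁
  rw [← hR, ← hP, ← mul_pow] at hK₂
  rw [← hP, ← hQ, ← mul_pow] at hK₃
  obtain rfl := eq_mul_of_tanh_eq hs (by linarith) hP₀ hQ₀ hR₀ hPS hQS hRS ht₁ ht₂ ht₃ hK₁ hK₂ hK₃
  obtain rfl := eq_mul_of_tanh_eq hs (by linarith) hQ₀ hR₀ hP₀ hQS hRS hPS ht₂ ht₃ ht₁ hK₂ hK₃ hK₁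
  obtain rfl := eq_mul_of_tanh_eq hs (by linarith) hR₀ hP₀ hQ₀ hRS hPS hQS ht₃ ht₁ ht₂ hK₃ hK₁ hK₂
  have hx := Real.sinh_pos_iff.2 hξ
  have hy := Real.sinh_pos_iff.2 hη
  have hz := Real.sinh_pos_iff.2 hζ
  have hD₁ := (malfatti_denom_pos (q := Real.sinh ζ) hS hy.le hyS).ne'
  have hD₂ := (malfatti_denom_pos (q := Real.sinh ξ) hS hz.le hzS).ne'
  have hD₃ := (malfatti_denom_pos (q := Real.sinh η) hS hx.le hxS).ne'
  have hC := Real.cosh_sq' σ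
  have hcx := Real.cosh_sq' ξ
  have hcy := Real.cosh_sq' η
  have hcz := Real.cosh_sq' ζ
  have identity₁ := malfatti_identity hC hcx hcy hcz hP hQ hR
  have identity₂ := malfatti_identity hC hcy hcz hcx hQ hR hP
  have identity₃ := malfatti_identity hC hcz hcx hcy hR hP hQ
  have sub₁ := subsidiary_equation hD₁ hD₂ hD₃ hcL hcm hcn hsL hsm hsn identity₁
  have sub₂ := subsidiary_equation hD₂ hD₃ hD₁ hcM hcn hcl hsM hsn hsl identity₂
  have sub₃ := subsidiary_equation hD₃ hD₁ hD₂ hcN hcl hcm hsN hsl hsm identity₃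
  refine ⟨l + 2 * u₁, m + 2 * u₂, n + 2 * u₃, sub₁, sub₂, sub₃, ?_⟩
  have half_add : ∀ x u : ℝ, (2 * σ + (x + 2 * u) - x) / 2 = σ + u := fun _ _ => by ring
  have half_sub : ∀ x u : ℝ, (2 * σ - (x + 2 * u) + x) / 2 = σ - u := fun _ _ => by ring
  have half : ∀ x u : ℝ, (x + 2 * u + x) / 2 = x + u := fun _ _ => by ring
  simp only [half_add, half_sub, half]
  exact ⟨hp₁, hm₁, hp₂, hm₂, hp₃, hm₃⟩
end

section
/- Let (O₁, r₁) and (O₂, r₂) be two circles in the Euclidean plane E with r₁ ≠ r₂, r₁, r₂ > 0, and dist(O₁, O₂) > r₁ + r₂ (disjoint circles). Let c := (r₁ • O₂ − r₂ • O₁) / (r₁ − r₂) be their external centre of similitude (using the affine combination c = ((r₁/(r₁−r₂)) • O₂ + (−r₂/(r₁−r₂)) • O₁)). Then there exists R > 0 such that the inversion of E with centre c and radius R maps the sphere {X : dist(X, O₁) = r₁} onto the sphere {X : dist(X, O₂) = r₂}, i.e., the two circles are images of each other under this inversion. -/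
open EuclideanGeometry in
/-- Inversion about `c` maps the sphere homothetic to the unit sphere about `c + w` with ratio `r`
into the one with ratio `s`, when the squared radius is `r * s` times the power of `c` with respect
to that unit sphere. -/
theorem mapsTo_inversion_sphere_of_homothetic {V : Type*} [NormedAddCommGroup V]
    [InnerProductSpace ℝ V] (c w : V) {r s R : ℝ} (hr : 0 < r) (hs : 0 < s) (hw : 1 < ‖w‖)
    (hR : R ^ 2 = r * s * (‖w‖ ^ 2 - 1)) :
    Set.MapsTo (inversion c R) (Metric.sphere (c + r • w) r) (Metric.sphere (c + s • w) s) := by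
  intro X hX
  obtain ⟨x, rfl⟩ : ∃ x, X = c + x := ⟨X - c, by abel⟩
  rw [mem_sphere_iff_norm, add_sub_add_left_eq_sub] at hX
  have hx : x ≠ 0 := by
    rintro rfl
    rw [zero_sub, norm_neg, norm_smul, Real.norm_of_nonneg hr.le] at hX
    nlinarith
  have hx' : ‖x‖ ≠ 0 := norm_ne_zero_iff.2 hx
  have hX2 : ‖x - r • w‖ ^ 2 = r ^ 2 := by rw [hX]
  rw [norm_sub_sq_real, norm_smul, inner_smul_right, Real.norm_of_nonneg hr.le] at hX2
  have hinv : inversion c R (c + x) = c + (R / ‖x‖) ^ 2 • x := by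
    simp [inversion, add_comm]
  rw [mem_sphere_iff_norm, hinv, add_sub_add_left_eq_sub, ← sq_eq_sq₀ (norm_nonneg _) hs.le,
    norm_sub_sq_real, norm_smul, norm_smul, inner_smul_right, real_inner_smul_left,
    Real.norm_of_nonneg hs.le, Real.norm_of_nonneg (sq_nonneg _), div_pow, hR]
  field_simp
  linear_combination (‖w‖ ^ 2 - 1) * hX2

/-- Step 1 of Steiner's construction: two disjoint circles with distinct radii are
images of each other under a suitable inversion centred at their external centre of
similitude. -/
theorem inversion_at_external_similitude_centre
    (O₁ O₂ : EuclideanSpace ℝ (Fin 2)) (r₁ r₂ : ℝ)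
    (hr₁ : 0 < r₁) (hr₂ : 0 < r₂) (hne : r₁ ≠ r₂)
    (hd : r₁ + r₂ < dist O₁ O₂) :
    ∃ R > 0,
      EuclideanGeometry.inversion ((r₁ - r₂)⁻¹ • (r₁ • O₂ - r₂ • O₁)) R ''
          Metric.sphere O₁ r₁ = Metric.sphere O₂ r₂ := by
  set c := (r₁ - r₂)⁻¹ • (r₁ • O₂ - r₂ • O₁) with hc
  set w := (r₁ - r₂)⁻¹ • (O₁ - O₂) with hw_def
  have hsub : r₁ - r₂ ≠ 0 := sub_ne_zero.2 hne
  have h₁ : O₁ = c + r₁ • w := by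
    rw [hc, hw_def]
    match_scalars <;> field_simp <;> ring
  have h₂ : O₂ = c + r₂ • w := by
    rw [hc, hw_def]
    match_scalars <;> field_simp <;> ring
  have hw : 1 < ‖w‖ := by
    rw [hw_def, norm_smul, norm_inv, Real.norm_eq_abs, ← dist_eq_norm, inv_mul_eq_div,
      one_lt_div (abs_pos.2 hsub)]
    exact (abs_sub_lt_iff.2 ⟨by linarith, by linarith⟩ : |r₁ - r₂| < r₁ + r₂).trans hd
  have hpos : 0 < r₁ * r₂ * (‖w‖ ^ 2 - 1) := by
    have : 0 < ‖w‖ ^ 2 - 1 := by nlinarith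
    positivity
  have hR := Real.sq_sqrt hpos.le
  refine ⟨√(r₁ * r₂ * (‖w‖ ^ 2 - 1)), Real.sqrt_pos.2 hpos, ?_⟩
  clear_value c w
  subst h₁ h₂
  refine Set.Subset.antisymm
    (mapsTo_inversion_sphere_of_homothetic c w hr₁ hr₂ hw hR).image_subset fun Y hY => ?_
  exact ⟨_, mapsTo_inversion_sphere_of_homothetic c w hr₂ hr₁ hw (by rw [hR, mul_comm r₁]) hY,
    EuclideanGeometry.inversion_inversion c (Real.sqrt_pos.2 hpos).ne' Y⟩
end
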